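/- Let θ ∈ (0, π/10]. If q is an action minimizer of A over P(Q_S, Q_{E₁}) such that q₂(1) = q₃(1) and q has no collision at t = 0, then its action satisfies A(q) ≥ (3/16)·16^{1/3}·[ 2·(2π²)^{1/3} + (π/2 + 2θ)^{2/3} + (π/2 + 3θ)^{2/3} + θ^{2/3} ]. -/

import Mathlib

open Real MeasureTheory Set
open scoped ENNReal

noncomputable section

/-- Euclidean norm on `ℝ × ℝ` (row vectors in the plane). -/
def enorm2 (v : ℝ × ℝ) : ℝ := Real.sqrt (v.1 ^ 2 + v.2 ^ 2)

/-- Row vector multiplied on the right by the rotation matrix `R θ`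
with rows `(cos θ, sin θ)` and `(-sin θ, cos θ)`. -/
def rotV (θ : ℝ) (v : ℝ × ℝ) : ℝ × ℝ :=
  (v.1 * Real.cos θ - v.2 * Real.sin θ, v.1 * Real.sin θ + v.2 * Real.cos θ)

/-- `H¹([0,1],(ℝ²)⁴)`: absolutely continuous paths `[0,1] → (ℝ²)⁴` with
square-integrable derivative, recorded via an integrable (a.e.-)derivative `v`
together with the integral representation of `q`. -/
structure H1Path4 where
  q : ℝ → Fin 4 → ℝ × ℝ
  v : ℝ → Fin 4 → ℝ × ℝ
  hvInt : ∀ i : Fin 4, IntegrableOn (fun t => v t i) (Icc (0:ℝ) 1)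
  hrep : ∀ i : Fin 4, ∀ t ∈ Icc (0:ℝ) 1, q t i = q 0 i + ∫ s in (0:ℝ)..t, v s i
  hL2 : ∀ i : Fin 4, IntegrableOn (fun t => enorm2 (v t i) ^ 2) (Icc (0:ℝ) 1)

/-- Center of mass at the origin throughout `[0,1]` (the path lies in `χ`). -/
def H1Path4.inChi (p : H1Path4) : Prop := ∀ t ∈ Icc (0:ℝ) 1, ∑ i, p.q t i = 0

/-- The Lagrangian action functional `A`, with value `+∞` allowed. -/
def action (p : H1Path4) : ℝ≥0∞ :=
  ∫⁻ t in Icc (0:ℝ) 1,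
    (ENNReal.ofReal ((1/2) * ∑ i, enorm2 (p.v t i) ^ 2)
      + ∑ i : Fin 4, ∑ j ∈ Finset.univ.filter (fun j => i < j),
          (ENNReal.ofReal (enorm2 (p.q t i - p.q t j)))⁻¹)

/-- The starting boundary configuration set `Q_S` (double isosceles with order
constraints). -/
def QSset : Set (Fin 4 → ℝ × ℝ) :=
  { c | ∃ a₁ b₁ c₁ : ℝ, 0 ≤ b₁ ∧ 0 ≤ c₁ ∧
      c = ![(-a₁ - c₁, 0), (-a₁, 0), ((2*a₁ + c₁)/2, b₁), ((2*a₁ + c₁)/2, -b₁)] }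

/-- The ending boundary configuration set `Q_{E₁}`. -/
def QE1set (θ : ℝ) : Set (Fin 4 → ℝ × ℝ) :=
  { c | ∃ a₂ b₂ c₂ : ℝ, 0 ≤ b₂ ∧ 0 ≤ c₂ ∧
      c = fun i => rotV θ (![(-b₂, -a₂), (-c₂, a₂), (c₂, a₂), (b₂, -a₂)] i) }

/-- The ending boundary configuration set `Q_{E₂}`. -/
def QE2set (θ : ℝ) : Set (Fin 4 → ℝ × ℝ) :=
  { c | ∃ a₂ b₂ c₂ : ℝ, 0 ≤ b₂ ∧ 0 ≤ c₂ ∧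
      c = fun i => rotV θ (![(-a₂, -b₂), (-a₂, b₂), (a₂, c₂), (a₂, -c₂)] i) }

/-- Membership in the admissible class `P(Q_S, E)`. -/
def inAdm (E : Set (Fin 4 → ℝ × ℝ)) (p : H1Path4) : Prop :=
  p.inChi ∧ p.q 0 ∈ QSset ∧ p.q 1 ∈ E

/-- `p` is an action minimizer over `P(Q_S, E)`. -/
def isMin (E : Set (Fin 4 → ℝ × ℝ)) (p : H1Path4) : Prop :=
  inAdm E p ∧ ∀ p' : H1Path4, inAdm E p' → action p ≤ action p'

/-- The Newtonian equations of the equal-mass four-body problem, on a set `s`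
of times. -/
def newton (Q : ℝ → Fin 4 → ℝ × ℝ) (s : Set ℝ) : Prop :=
  ∀ i : Fin 4, ∀ t ∈ s,
    deriv (deriv (fun u => Q u i)) t =
      ∑ j ∈ Finset.univ.erase i, (1 / enorm2 (Q t j - Q t i) ^ 3) • (Q t j - Q t i)

/-- `x` is absolutely continuous on `[0,1]` with almost everywhere derivative `u`. -/
def HasWeakDeriv (x u : ℝ → ℝ) : Prop :=
  AbsolutelyContinuousOnInterval x 0 1 ∧ ∀ᵐ t, t ∈ uIcc (0:ℝ) 1 → HasDerivAt x (u t) t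

/-- `Φ` is absolutely continuous on `[0,1]` and its derivative is almost everywhere at most `L`. -/
def IsMinorant (Φ L : ℝ → ℝ) : Prop :=
  AbsolutelyContinuousOnInterval Φ 0 1 ∧
    ∀ᵐ t, t ∈ uIcc (0:ℝ) 1 → ∃ d ≤ L t, HasDerivAt Φ d t

lemma HasWeakDeriv.sub {x u y w : ℝ → ℝ} (hx : HasWeakDeriv x u) (hy : HasWeakDeriv y w) :
    HasWeakDeriv (fun t => x t - y t) (fun t => u t - w t) := by
  refine ⟨hx.1.fun_sub hy.1, ?_⟩
  filter_upwards [hx.2, hy.2] with t h1 h2 ht using (h1 ht).sub (h2 ht)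

lemma HasWeakDeriv.add {x u y w : ℝ → ℝ} (hx : HasWeakDeriv x u) (hy : HasWeakDeriv y w) :
    HasWeakDeriv (fun t => x t + y t) (fun t => u t + w t) := by
  refine ⟨hx.1.fun_add hy.1, ?_⟩
  filter_upwards [hx.2, hy.2] with t h1 h2 ht using (h1 ht).add (h2 ht)

lemma HasWeakDeriv.mul {x u y w : ℝ → ℝ} (hx : HasWeakDeriv x u) (hy : HasWeakDeriv y w) :
    HasWeakDeriv (fun t => x t * y t) (fun t => u t * y t + x t * w t) := by
  refine ⟨hx.1.fun_mul hy.1, ?_⟩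
  filter_upwards [hx.2, hy.2] with t h1 h2 ht using (h1 ht).mul (h2 ht)

lemma HasWeakDeriv.of_hasDerivAt {f f' : ℝ → ℝ}
    (hf : ∀ t ∈ uIcc (0:ℝ) 1, HasDerivAt f (f' t) t) (hf' : ContinuousOn f' (uIcc 0 1)) :
    HasWeakDeriv f f' := by
  refine ⟨?_, Filter.Eventually.of_forall hf⟩
  obtain ⟨C, hC⟩ := isCompact_uIcc.exists_bound_of_continuousOn hf'
  have hC0 : 0 ≤ C := (norm_nonneg _).trans (hC 0 (by simp))
  exact (Convex.lipschitzOnWith_of_nnnorm_hasDerivWithin_le (C := ⟨C, hC0⟩) (convex_uIcc 0 1)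
    (fun t ht => (hf t ht).hasDerivWithinAt) hC).absolutelyContinuousOnInterval

lemma HasWeakDeriv.const (c : ℝ) : HasWeakDeriv (fun _ => c) (fun _ => 0) :=
  .of_hasDerivAt (fun t _ => hasDerivAt_const t c) continuousOn_const

lemma HasWeakDeriv.of_integral (c : ℝ) {u : ℝ → ℝ} (hu : IntegrableOn u (Icc 0 1)) :
    HasWeakDeriv (fun t => c + ∫ s in (0:ℝ)..t, u s) u := by
  have hi : IntervalIntegrable u volume 0 1 :=
    (intervalIntegrable_iff_integrableOn_Icc_of_le zero_le_one).2 hu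
  have h : HasWeakDeriv (fun t => ∫ s in (0:ℝ)..t, u s) u := by
    refine ⟨hi.absolutelyContinuousOnInterval_intervalIntegral (by simp), ?_⟩
    filter_upwards [hi.ae_hasDerivAt_integral] with t h ht using h ht 0 (by simp)
  simpa using (HasWeakDeriv.const c).add h

lemma HasWeakDeriv.isMinorant {x u L : ℝ → ℝ} (hx : HasWeakDeriv x u)
    (hL : ∀ t ∈ uIcc (0:ℝ) 1, u t ≤ L t) : IsMinorant x L := by
  refine ⟨hx.1, ?_⟩
  filter_upwards [hx.2] with t h ht using ⟨u t, hL t ht, h ht⟩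

lemma IsMinorant.add {Φ Ψ L M : ℝ → ℝ} (h : IsMinorant Φ L) (k : IsMinorant Ψ M) :
    IsMinorant (fun t => Φ t + Ψ t) (fun t => L t + M t) := by
  refine ⟨h.1.fun_add k.1, ?_⟩
  filter_upwards [h.2, k.2] with t h1 k1 ht
  obtain ⟨d, hd, hd'⟩ := h1 ht
  obtain ⟨e, he, he'⟩ := k1 ht
  exact ⟨d + e, add_le_add hd he, hd'.add he'⟩

lemma IsMinorant.ofReal_sub_le_lintegral {Φ L : ℝ → ℝ} {G : ℝ → ℝ≥0∞} (h : IsMinorant Φ L)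
    (hG : ∀ t ∈ Icc (0:ℝ) 1, ENNReal.ofReal (L t) ≤ G t) :
    ENNReal.ofReal (Φ 1 - Φ 0) ≤ ∫⁻ t in Icc (0:ℝ) 1, G t := by
  have hint : IntegrableOn (deriv Φ) (Icc 0 1) :=
    (intervalIntegrable_iff_integrableOn_Icc_of_le zero_le_one).1 h.1.intervalIntegrable_deriv
  have hpos : IntegrableOn (fun t => max (deriv Φ t) 0) (Icc 0 1) := hint.pos_part
  have heq : Φ 1 - Φ 0 = ∫ t in Icc (0:ℝ) 1, deriv Φ t := by
    rw [← h.1.integral_deriv_eq_sub, intervalIntegral.integral_of_le zero_le_one,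
      integral_Icc_eq_integral_Ioc]
  calc ENNReal.ofReal (Φ 1 - Φ 0)
      ≤ ENNReal.ofReal (∫ t in Icc (0:ℝ) 1, max (deriv Φ t) 0) := by
        rw [heq]
        exact ENNReal.ofReal_le_ofReal (integral_mono hint hpos fun t => le_max_left _ _)
    _ = ∫⁻ t in Icc (0:ℝ) 1, ENNReal.ofReal (max (deriv Φ t) 0) :=
        ofReal_integral_eq_lintegral_ofReal hpos
          (Filter.Eventually.of_forall fun t => le_max_right _ _)
    _ ≤ ∫⁻ t in Icc (0:ℝ) 1, G t := by
        refine setLIntegral_mono_ae' measurableSet_Icc ?_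
        filter_upwards [h.2] with t ht hmem
        obtain ⟨d, hd, hd'⟩ := ht (by rwa [uIcc_of_le zero_le_one])
        refine le_trans ?_ (hG t hmem)
        rw [hd'.deriv]
        rcases le_total d 0 with h0 | h0
        · simp [h0]
        · rw [max_eq_left h0]
          exact ENNReal.ofReal_le_ofReal hd

/-- A calibration of `x'² - a x²` by a Riccati subsolution `h`, centred at a solution `s` of
`s'' = -a s`. -/
lemma isMinorant_riccati {x u h h' s s' a : ℝ → ℝ} (hx : HasWeakDeriv x u)
    (hh : HasWeakDeriv h h') (hs : HasWeakDeriv s s')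
    (hs' : HasWeakDeriv s' fun t => - a t * s t)
    (hric : ∀ t ∈ uIcc (0:ℝ) 1, h' t + h t ^ 2 ≤ - a t) :
    IsMinorant (fun t => h t * (x t - s t) ^ 2 + 2 * s' t * (x t - s t) + s t * s' t)
      (fun t => u t ^ 2 - a t * x t ^ 2) := by
  have hy := hx.sub hs
  have key := ((hh.mul (hy.mul hy)).add
    (((HasWeakDeriv.const 2).mul hs').mul hy)).add (hs.mul hs')
  have key' := key.isMinorant (L := fun t => u t ^ 2 - a t * x t ^ 2) (by
    intro t ht
    have h1 := mul_le_mul_of_nonneg_right (hric t ht) (sq_nonneg (x t - s t))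
    linear_combination h1 + sq_nonneg (u t - s' t - h t * (x t - s t)))
  simpa only [pow_two] using key'

lemma IsMinorant.const_mul {Φ L : ℝ → ℝ} {c : ℝ} (hc : 0 ≤ c) (h : IsMinorant Φ L) :
    IsMinorant (fun t => c * Φ t) (fun t => c * L t) := by
  refine ⟨h.1.const_mul c, ?_⟩
  filter_upwards [h.2] with t h1 ht
  obtain ⟨d, hd, hd'⟩ := h1 ht
  exact ⟨c * d, mul_le_mul_of_nonneg_left hd hc, hd'.const_mul c⟩

lemma isMinorant_riccati_zero {x u h h' a : ℝ → ℝ} (hx : HasWeakDeriv x u)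
    (hh : HasWeakDeriv h h') (hric : ∀ t ∈ uIcc (0:ℝ) 1, h' t + h t ^ 2 ≤ - a t) :
    IsMinorant (fun t => h t * x t ^ 2) (fun t => u t ^ 2 - a t * x t ^ 2) := by
  simpa using isMinorant_riccati (s := fun _ => 0) (s' := fun _ => 0) hx hh (.const 0)
    (by simpa using HasWeakDeriv.const 0) hric

lemma hasWeakDeriv_affine (m c : ℝ) : HasWeakDeriv (fun t => m * t + c) (fun _ => m) :=
  .of_hasDerivAt (fun t _ => by simpa using ((hasDerivAt_id t).const_mul m).add_const c)
    continuousOn_const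

lemma isMinorant_affine {x u : ℝ → ℝ} {m c a : ℝ} (hx : HasWeakDeriv x u)
    (h0 : m + c ^ 2 ≤ -a) (h1 : m + (m + c) ^ 2 ≤ -a) :
    IsMinorant (fun t => (m * t + c) * x t ^ 2) (fun t => u t ^ 2 - a * x t ^ 2) := by
  refine isMinorant_riccati_zero (a := fun _ => a) hx (hasWeakDeriv_affine m c) fun t ht => ?_
  rw [uIcc_of_le zero_le_one] at ht
  nlinarith [mul_nonneg ht.1 (sub_nonneg.2 ht.2), sq_nonneg m,
    mul_nonneg (mul_nonneg ht.1 (sub_nonneg.2 ht.2)) (sq_nonneg m), ht.1, ht.2]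

/-- Hardy-type calibration for a coordinate that vanishes at time `1`. -/
lemma isMinorant_hardy {x u : ℝ → ℝ} {σ : ℝ} (hσ : 1 < σ) (hx : HasWeakDeriv x u) :
    IsMinorant (fun t => -(1 / (2 * (σ - t))) * x t ^ 2)
      (fun t => u t ^ 2 - 1 / (4 * (σ - t) ^ 2) * x t ^ 2) := by
  have hpos : ∀ t ∈ uIcc (0:ℝ) 1, 0 < σ - t := fun t ht => by
    rw [uIcc_of_le zero_le_one] at ht; linarith [ht.2]
  refine isMinorant_riccati_zero (a := fun t => 1 / (4 * (σ - t) ^ 2))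
    (h' := fun t => -(1 / (2 * (σ - t) ^ 2))) hx
    (.of_hasDerivAt (fun t ht => ?_) ?_) fun t ht => ?_
  · have := hpos t ht
    have h := (((hasDerivAt_id t).const_sub σ).const_mul 2).inv (by simp; linarith)
    convert! h.neg using 1
    · ext; simp
    · simp; field_simp
  · refine (continuousOn_const.div (by fun_prop) fun t ht => ?_).neg
    have := hpos t ht
    positivity
  · have := hpos t ht
    apply le_of_eq
    field_simp
    norm_num

/-- Calibration of the harmonic oscillator of frequency `π/4`. -/
lemma isMinorant_oscillator {x u : ℝ → ℝ} (hx : HasWeakDeriv x u) (A B : ℝ) {s s' : ℝ → ℝ}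
    (hs : s = fun t => A * cos (π / 4 * t) + B * sin (π / 4 * t))
    (hs' : s' = fun t => π / 4 * (B * cos (π / 4 * t) - A * sin (π / 4 * t))) :
    IsMinorant (fun t => (1 / (t + 1 / 4) - 4 / 5) * (x t - s t) ^ 2
        + 2 * s' t * (x t - s t) + s t * s' t)
      (fun t => u t ^ 2 - (π / 4) ^ 2 * x t ^ 2) := by
  have hpos : ∀ t ∈ uIcc (0:ℝ) 1, 0 < t + 1 / 4 := fun t ht => by
    rw [uIcc_of_le zero_le_one] at ht; linarith [ht.1]
  have hlin (t : ℝ) : HasDerivAt (fun t => π / 4 * t) (π / 4) t := by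
    simpa using (hasDerivAt_id t).const_mul (π / 4)
  refine isMinorant_riccati (a := fun _ => (π / 4) ^ 2)
    (h' := fun t => -(1 / (t + 1 / 4) ^ 2)) hx
    (.of_hasDerivAt (fun t ht => ?_) ?_) (.of_hasDerivAt (fun t _ => ?_) ?_)
    (.of_hasDerivAt (fun t _ => ?_) ?_) fun t ht => ?_
  · have := hpos t ht
    have h := (((hasDerivAt_id t).add_const (1 / 4)).inv (by simpa using this.ne')).sub_const (4/5)
    convert! h using 1
    · ext; simp
    · simp; field_simp
  · refine (continuousOn_const.div (by fun_prop) fun t ht => ?_).neg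
    have := hpos t ht
    positivity
  · rw [hs, hs']
    convert! ((hlin t).cos.const_mul A).add ((hlin t).sin.const_mul B) using 1
    ring
  · rw [hs']; fun_prop
  · rw [hs, hs']
    convert! (((hlin t).cos.const_mul B).sub ((hlin t).sin.const_mul A)).const_mul (π / 4) using 1
    ring
  · rw [hs]; fun_prop
  · have h0 := hpos t ht
    rw [uIcc_of_le zero_le_one] at ht
    have h1 : 4 / 5 ≤ 1 / (t + 1 / 4) := by
      rw [le_div_iff₀ h0]; linarith [ht.2]
    have h2 : 1 / (t + 1 / 4) ^ 2 = (1 / (t + 1 / 4)) ^ 2 := by rw [div_pow, one_pow]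
    rw [h2]
    nlinarith [pi_lt_d2, pi_pos]

lemma ofReal_le_inv_ofReal {κ a d : ℝ} (hκ : 0 ≤ κ) (ha : 4 * κ ^ 3 ≤ a) (hd : 0 ≤ d) :
    ENNReal.ofReal (3 / 2 * κ - a / 8 * d ^ 2) ≤ (ENNReal.ofReal d)⁻¹ := by
  rcases hd.eq_or_lt with rfl | hd
  · simp
  · rw [← ENNReal.ofReal_inv_of_pos hd]
    refine ENNReal.ofReal_le_ofReal ?_
    rw [← one_div, le_div_iff₀ hd]
    have h1 := mul_le_mul_of_nonneg_right ha (pow_nonneg hd.le 3)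
    have h2 : 0 ≤ (κ * d - 1) ^ 2 * (κ * d + 2) := by positivity
    nlinarith

lemma enorm2_sq (v : ℝ × ℝ) : enorm2 v ^ 2 = v.1 ^ 2 + v.2 ^ 2 :=
  Real.sq_sqrt (by positivity)

/-- Lower bound of one pair's contribution to the Lagrangian, as used in the calibrations:
its share of the kinetic energy, minus a quadratic term in the distance, plus a constant. -/
def pairBound (p : H1Path4) (i j : Fin 4) (κ a t : ℝ) : ℝ :=
  1 / 8 * ((((p.v t i).1 - (p.v t j).1) ^ 2 - a * ((p.q t i).1 - (p.q t j).1) ^ 2)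
    + (((p.v t i).2 - (p.v t j).2) ^ 2 - a * ((p.q t i).2 - (p.q t j).2) ^ 2)) + 3 / 2 * κ

lemma pairBound_eq (p : H1Path4) (i j : Fin 4) (κ a t : ℝ) :
    pairBound p i j κ a t = 1 / 8 * enorm2 (p.v t i - p.v t j) ^ 2
      + (3 / 2 * κ - a / 8 * enorm2 (p.q t i - p.q t j) ^ 2) := by
  simp only [pairBound, enorm2_sq, Prod.fst_sub, Prod.snd_sub]
  ring

lemma sum_pairs_velocity_le (v : Fin 4 → ℝ × ℝ) :
    ∑ i : Fin 4, ∑ j ∈ Finset.univ.filter (fun j => i < j), 1 / 8 * enorm2 (v i - v j) ^ 2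
      ≤ (1 / 2) * ∑ i, enorm2 (v i) ^ 2 := by
  simp only [enorm2_sq, Prod.fst_sub, Prod.snd_sub, Finset.sum_filter, Fin.sum_univ_four]
  simp
  linarith [sq_nonneg ((v 0).1 + (v 1).1 + (v 2).1 + (v 3).1),
    sq_nonneg ((v 0).2 + (v 1).2 + (v 2).2 + (v 3).2)]

lemma ofReal_sum_pairBound_le (p : H1Path4) {κ a : Fin 4 → Fin 4 → ℝ} (hκ : ∀ i j, 0 ≤ κ i j)
    (ha : ∀ i j, 4 * κ i j ^ 3 ≤ a i j) (t : ℝ) :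
    ENNReal.ofReal (∑ i : Fin 4, ∑ j ∈ Finset.univ.filter (fun j => i < j),
        pairBound p i j (κ i j) (a i j) t)
      ≤ ENNReal.ofReal ((1/2) * ∑ i, enorm2 (p.v t i) ^ 2)
        + ∑ i : Fin 4, ∑ j ∈ Finset.univ.filter (fun j => i < j),
          (ENNReal.ofReal (enorm2 (p.q t i - p.q t j)))⁻¹ := by
  have hsum {ι : Type} (s : Finset ι) (f : ι → ℝ) :
      ENNReal.ofReal (∑ i ∈ s, f i) ≤ ∑ i ∈ s, ENNReal.ofReal (f i) :=
    Finset.le_sum_of_subadditive _ ENNReal.ofReal_zero.le (fun _ _ => ENNReal.ofReal_add_le) _ _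
  simp only [pairBound_eq, Finset.sum_add_distrib]
  refine ENNReal.ofReal_add_le.trans (add_le_add
    (ENNReal.ofReal_le_ofReal (sum_pairs_velocity_le _)) ?_)
  refine (hsum _ _).trans (Finset.sum_le_sum fun i _ => (hsum _ _).trans
    (Finset.sum_le_sum fun j _ => ?_))
  exact ofReal_le_inv_ofReal (hκ i j) (ha i j) (Real.sqrt_nonneg _)

/-- The contributions of the pairs `{1,2}` and `{3,4}` to the boundary term, for an end
configuration with rotated axes (`C = cos θ`, `S = sin θ`). -/
lemma oscillator_boundary {C S k c ρ α β : ℝ} (hCS : C ^ 2 + S ^ 2 = 1) :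
    (-ρ * (2 * S * C) - c) * (2 * (β * C - 2 * α * S) - k * (c - ρ * (2 * S * C)))
      + ρ * (C ^ 2 - S ^ 2) * (2 * (β * S + 2 * α * C) - k * (ρ * (C ^ 2 - S ^ 2)))
      + c * (C ^ 2 - S ^ 2) * (2 * (β * C + 2 * α * S) - k * (c * (C ^ 2 - S ^ 2)))
      + (c * (2 * S * C) + ρ) * (2 * (β * S - 2 * α * C) - k * (c * (2 * S * C) - ρ)) = 0 := by
  linear_combination (2 * (β * (c * C - ρ * S) + 2 * α * (ρ * C - c * S))
    - k * (ρ ^ 2 + c ^ 2) * (C ^ 2 + S ^ 2 + 1)) * hCS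

/-- The Kepler-type lower bound `3/2 ∑ κ` exceeds the claimed value. -/
lemma numeric_bound {θ : ℝ} (hθ0 : 0 < θ) (hθ1 : θ ≤ π / 10) :
    (3/16) * (16:ℝ) ^ ((1:ℝ)/3) *
      (2 * (2 * π^2) ^ ((1:ℝ)/3) + (π/2 + 2*θ) ^ ((2:ℝ)/3)
        + (π/2 + 3*θ) ^ ((2:ℝ)/3) + θ ^ ((2:ℝ)/3))
      ≤ 3 / 2 * (53 / 100 * 2 + 1 / 4 * 3 + 3 * (396 / 1000) * (1 - 1 / 100)) := by
  have hπ := pi_lt_d4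
  have hπ0 := pi_pos
  have third {x c : ℝ} (hx : 0 ≤ x) (hc : 0 ≤ c) (h : x ≤ c ^ 3) : x ^ ((1:ℝ)/3) ≤ c := by
    calc x ^ ((1:ℝ)/3) ≤ (c ^ 3) ^ ((1:ℝ)/3) := by gcongr
      _ = c := by rw [← Real.rpow_natCast, ← Real.rpow_mul hc]; norm_num
  have two_thirds {x c : ℝ} (hx : 0 ≤ x) (hc : 0 ≤ c) (h : x ^ 2 ≤ c ^ 3) :
      x ^ ((2:ℝ)/3) ≤ c := by
    have := third (sq_nonneg x) hc h
    rwa [← Real.rpow_natCast, ← Real.rpow_mul hx, show ((2:ℕ):ℝ) * (1 / 3) = 2 / 3 by norm_num]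
      at this
  have h16 : (16:ℝ) ^ ((1:ℝ)/3) ≤ 252 / 100 := third (by norm_num) (by norm_num) (by norm_num)
  have h1 : (2 * π^2) ^ ((1:ℝ)/3) ≤ 2703 / 1000 :=
    third (by positivity) (by norm_num) (by nlinarith)
  have h2 : (π/2 + 2*θ) ^ ((2:ℝ)/3) ≤ 1692 / 1000 :=
    two_thirds (by positivity) (by norm_num) (by nlinarith)
  have h3 : (π/2 + 3*θ) ^ ((2:ℝ)/3) ≤ 1850 / 1000 :=
    two_thirds (by positivity) (by norm_num) (by nlinarith)
  have h4 : θ ^ ((2:ℝ)/3) ≤ 463 / 1000 := two_thirds hθ0.le (by norm_num) (by nlinarith)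
  calc
    _ ≤ (3/16) * (252 / 100 : ℝ)
        * (2 * (2703 / 1000) + 1692 / 1000 + 1850 / 1000 + 463 / 1000) := by gcongr
    _ ≤ _ := by norm_num

lemma H1Path4.hasWeakDeriv_coords (p : H1Path4) (i : Fin 4) :
    ∃ x y : ℝ → ℝ, HasWeakDeriv x (fun t => (p.v t i).1) ∧ HasWeakDeriv y (fun t => (p.v t i).2) ∧
      ∀ t ∈ Icc (0:ℝ) 1, p.q t i = (x t, y t) := by
  refine ⟨_, _, .of_integral (p.q 0 i).1 (p.hvInt i).fst, .of_integral (p.q 0 i).2 (p.hvInt i).snd,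
    fun t ht => ?_⟩
  have hi : IntegrableOn (fun s => p.v s i) (Ioc 0 t) :=
    (p.hvInt i).mono_set fun s hs => ⟨hs.1.le, hs.2.trans ht.2⟩
  rw [p.hrep i t ht]
  simp only [intervalIntegral.integral_of_le ht.1]
  rw [← fst_integral hi, ← snd_integral hi]
  rfl

/-- Primitive of the constant term in the calibration of the colliding pair. -/
lemma isMinorant_rpow {σ : ℝ} (hσ : 1 < σ) (c : ℝ) :
    IsMinorant (fun t => -3 * c * (σ - t) ^ ((1:ℝ)/3)) (fun t => c * (σ - t) ^ (-(2:ℝ)/3)) := by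
  have hpos : ∀ t ∈ uIcc (0:ℝ) 1, 0 < σ - t := fun t ht => by
    rw [uIcc_of_le zero_le_one] at ht; linarith [ht.2]
  refine HasWeakDeriv.isMinorant (.of_hasDerivAt (fun t ht => ?_) ?_) fun t _ => le_rfl
  · have h := (((hasDerivAt_id t).const_sub σ).rpow_const (p := 1 / 3)
      (Or.inl (hpos t ht).ne')).const_mul (-3 * c)
    convert! h using 1
    simp only [id]
    norm_num
    ring
  · exact continuousOn_const.mul
      (ContinuousOn.rpow_const (by fun_prop) fun t ht => Or.inl (hpos t ht).ne')

lemma isMinorant_pairBound (p : H1Path4) {i j : Fin 4} {x y Φ Ψ K κ a : ℝ → ℝ}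
    (hq : ∀ t ∈ Icc (0:ℝ) 1, p.q t i - p.q t j = (x t, y t))
    (hΦ : IsMinorant Φ fun t => ((p.v t i).1 - (p.v t j).1) ^ 2 - a t * x t ^ 2)
    (hΨ : IsMinorant Ψ fun t => ((p.v t i).2 - (p.v t j).2) ^ 2 - a t * y t ^ 2)
    (hK : IsMinorant K κ) :
    IsMinorant (fun t => 1 / 8 * (Φ t + Ψ t) + 3 / 2 * K t)
      (fun t => pairBound p i j (κ t) (a t) t) := by
  have h := ((hΦ.add hΨ).const_mul (c := 1 / 8) (by norm_num)).add
    (hK.const_mul (c := 3 / 2) (by norm_num))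
  refine ⟨h.1, ?_⟩
  filter_upwards [h.2] with t ht hmem
  obtain ⟨d, hd, hd'⟩ := ht hmem
  refine ⟨d, hd.trans_eq ?_, hd'⟩
  rw [uIcc_of_le zero_le_one] at hmem
  obtain ⟨h1, h2⟩ := Prod.ext_iff.1 (hq t hmem)
  simp only [Prod.fst_sub, Prod.snd_sub] at h1 h2
  simp only [pairBound, h1, h2]

lemma IsMinorant.constant (κ : ℝ) : IsMinorant (fun t => κ * t) (fun _ => κ) := by
  simpa using (hasWeakDeriv_affine κ 0).isMinorant fun t _ => le_rfl

lemma rotV_collision {θ a c : ℝ} (h : rotV θ (-c, a) = rotV θ (c, a)) : c = 0 := by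
  simp only [rotV, Prod.mk.injEq] at h
  obtain ⟨h1, h2⟩ := h
  linear_combination (-c) * sin_sq_add_cos_sq θ - cos θ / 2 * h1 - sin θ / 2 * h2

/-- for `θ ∈ (0, π/10]`, an action minimizer over `P(Q_S, Q_{E₁})`
with `q₂(1) = q₃(1)` and no collision at `t = 0` has action at least
`(3/16)·16^{1/3}·[2(2π²)^{1/3} + (π/2+2θ)^{2/3} + (π/2+3θ)^{2/3} + θ^{2/3}]`. -/
theorem statement15 (θ : ℝ) (hθ0 : 0 < θ) (hθ1 : θ ≤ π/10)
    (p : H1Path4) (hp : isMin (QE1set θ) p)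
    (hcol : p.q 1 1 = p.q 1 2)
    (hnc0 : ∀ i j : Fin 4, i ≠ j → p.q 0 i ≠ p.q 0 j) :
    ENNReal.ofReal ((3/16) * (16:ℝ) ^ ((1:ℝ)/3) *
      (2 * (2 * π^2) ^ ((1:ℝ)/3) + (π/2 + 2*θ) ^ ((2:ℝ)/3)
        + (π/2 + 3*θ) ^ ((2:ℝ)/3) + θ ^ ((2:ℝ)/3))) ≤ action p := by
  obtain ⟨⟨-, ⟨a₁, b₁, c₁, hb₁, hc₁, hS⟩, ⟨a₂, b₂, c₂, -, -, hE⟩⟩, -⟩ := hp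
  obtain rfl : c₂ = 0 := rotV_collision (θ := θ) (a := a₂) (by simpa [hE] using hcol)
  choose x y hx hy hq using p.hasWeakDeriv_coords
  have hd (i j : Fin 4) (t : ℝ) (ht : t ∈ Icc (0:ℝ) 1) :
      p.q t i - p.q t j = (x i t - x j t, y i t - y j t) := by
    rw [hq i t ht, hq j t ht]; rfl
  have hX (i j : Fin 4) := (hx i).sub (hx j)
  have hY (i j : Fin 4) := (hy i).sub (hy j)
  set C := cos θ with hC
  set S := sin θ with hS'
  have hCS : C ^ 2 + S ^ 2 = 1 := cos_sq_add_sin_sq θ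
  have hσ : (1:ℝ) < 1 + 1 / 10 ^ 6 := by norm_num
  set σ : ℝ := 1 + 1 / 10 ^ 6 with hσ'
  have m₁₂ := isMinorant_pairBound p (hd 0 1)
    (isMinorant_oscillator (hX 0 1) (-c₁) (2 * b₁ * (2 * S * C)) rfl rfl)
    (isMinorant_oscillator (hY 0 1) 0 (-(2 * b₁) * (C ^ 2 - S ^ 2)) rfl rfl)
    (.constant (53 / 100))
  have m₃₄ := isMinorant_pairBound p (hd 2 3)
    (isMinorant_oscillator (hX 2 3) 0 (-c₁ * (C ^ 2 - S ^ 2)) rfl rfl)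
    (isMinorant_oscillator (hY 2 3) (2 * b₁) (-c₁ * (2 * S * C)) rfl rfl)
    (.constant (53 / 100))
  have m₂₃ := isMinorant_pairBound p (hd 1 2) (isMinorant_hardy hσ (hX 1 2))
    (isMinorant_hardy hσ (hY 1 2)) (isMinorant_rpow hσ (396 / 1000))
  have chain (i j : Fin 4) {m c : ℝ} (h0 : m + c ^ 2 ≤ -(1 / 16))
      (h1 : m + (m + c) ^ 2 ≤ -(1 / 16)) :=
    isMinorant_pairBound p (hd i j) (isMinorant_affine (hX i j) h0 h1)
      (isMinorant_affine (hY i j) h0 h1) (.constant (1 / 4))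
  have m₂₄ := chain 1 3 (m := -31 / 100) (c := 49 / 100) (by norm_num) (by norm_num)
  have m₁₃ := chain 0 2 (m := -1 / 10) (c := -8 / 100) (by norm_num) (by norm_num)
  have m₁₄ := chain 0 3 (m := -8 / 100) (c := 8 / 100) (by norm_num) (by norm_num)
  have key := ((((m₁₂.add m₁₃).add m₁₄).add m₂₃).add m₂₄).add m₃₄
  refine le_trans (ENNReal.ofReal_le_ofReal ((numeric_bound hθ0 hθ1).trans ?_))
    (key.ofReal_sub_le_lintegral fun t ht => ?_)
  · have e0 (i : Fin 4) := (hq i 0 (by simp)).symm.trans (congrFun hS i)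
    have e1 (i : Fin 4) := (hq i 1 (by simp)).symm.trans (congrFun hE i)
    have e00 := e0 0
    have e01 := e0 1
    have e02 := e0 2
    have e03 := e0 3
    have e10 := e1 0
    have e11 := e1 1
    have e12 := e1 2
    have e13 := e1 3
    simp [rotV, ← hC, ← hS'] at e00 e01 e02 e03 e10 e11 e12 e13
    have hS0 : 0 ≤ S := sin_nonneg_of_nonneg_of_le_pi hθ0.le (by linarith [pi_pos])
    have hC0 : 0 ≤ C := cos_nonneg_of_mem_Icc ⟨by linarith [pi_pos], by linarith [pi_pos]⟩
    have hw1 : (σ - 1) ^ ((1:ℝ)/3) = 1 / 100 := by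
      rw [show σ - 1 = (1 / 100) ^ (3:ℝ) by norm_num [hσ'], ← Real.rpow_mul (by norm_num)]
      norm_num
    have hw0 : 1 ≤ (σ - 0) ^ ((1:ℝ)/3) := Real.one_le_rpow (by linarith) (by norm_num)
    have hh : 49 / 100 ≤ 1 / (2 * (σ - 0)) := by norm_num [hσ']
    have hz : (1:ℝ) / (1 + 1 / 4) - 4 / 5 = 0 := by norm_num
    rw [hw1, hz, mul_one (π / 4), mul_zero (π / 4), cos_zero, sin_zero, cos_pi_div_four,
      sin_pi_div_four]
    simp only [e00, e01, e02, e03, e10, e11, e12, e13]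
    generalize (σ - 0) ^ ((1:ℝ)/3) = w at hw0 ⊢
    generalize 1 / (2 * (σ - 0)) = h at hh ⊢
    have hosc := oscillator_boundary (k := √2 / 2) (c := -c₁) (ρ := -(2 * b₁)) (β := -b₂)
      (α := -a₂) hCS
    have h0 : 0 ≤ π * (b₁ * c₁ * (S * C)) := by positivity
    have hr := mul_nonneg (sub_nonneg.2 hh)
      (add_nonneg (sq_nonneg (-a₁ - (2 * a₁ + c₁) / 2)) (sq_nonneg b₁))
    linear_combination 1 / 8 * hr + 1 / 4 * h0 + 3 / 2 * 3 * (396 / 1000) * hw0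
      - π / 4 * (√2 / 2) / 8 * hosc
  · let κ : Fin 4 → Fin 4 → ℝ := ![![0, 53 / 100, 1 / 4, 1 / 4],
      ![0, 0, 396 / 1000 * (σ - t) ^ (-(2:ℝ)/3), 1 / 4], ![0, 0, 0, 53 / 100], ![0, 0, 0, 0]]
    let a : Fin 4 → Fin 4 → ℝ := ![![0, (π / 4) ^ 2, 1 / 16, 1 / 16],
      ![0, 0, 1 / (4 * (σ - t) ^ 2), 1 / 16], ![0, 0, 0, (π / 4) ^ 2], ![0, 0, 0, 0]]
    have hpos : 0 < σ - t := by linarith [ht.2]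
    have hcube : ((σ - t) ^ (-(2:ℝ)/3)) ^ 3 = 1 / (σ - t) ^ 2 := by
      rw [← Real.rpow_natCast, ← Real.rpow_mul hpos.le,
        show -(2:ℝ) / 3 * (3:ℕ) = -(2:ℕ) by norm_num, Real.rpow_neg hpos.le, Real.rpow_natCast,
        one_div]
    have hκ (i j : Fin 4) : 0 ≤ κ i j := by
      have := Real.rpow_nonneg hpos.le (-(2:ℝ)/3)
      fin_cases i <;> fin_cases j <;> simp [κ] <;> positivity
    have ha₂₃ : 4 * (396 / 1000 * (σ - t) ^ (-(2:ℝ)/3)) ^ 3 ≤ 1 / (4 * (σ - t) ^ 2) := by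
      rw [mul_pow, hcube, show 1 / (4 * (σ - t) ^ 2) = 1 / 4 * (1 / (σ - t) ^ 2) by field_simp,
        ← mul_assoc]
      gcongr
      norm_num
    have ha₁₂ : 4 * (53 / 100) ^ 3 ≤ (π / 4) ^ 2 := by nlinarith [pi_gt_d2]
    have ha (i j : Fin 4) : 4 * κ i j ^ 3 ≤ a i j := by
      fin_cases i <;> fin_cases j <;> simp only [κ, a] <;>
        first | exact ha₁₂ | exact ha₂₃ | (simp <;> norm_num)
    convert ofReal_sum_pairBound_le p hκ ha t using 2
    simp [Finset.sum_filter, Fin.sum_univ_four, κ, a]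
    ring

end
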